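/- In any MMA, every labelling designates at least one label for every argument: for any MMA (A,R,f_Q), any a ∈ A and any labelling λ of pre(a), there exists l ∈ L such that λ designates l for a in the MMA. -/

import Mathlib

inductive Label : Type
  | inn
  | out
  | undec
deriving DecidableEq

instance : Fintype Label where
  elems := ⟨([Label.inn, Label.out, Label.undec] : List Label), by decide⟩
  complete := by intro x; cases x <;> decide

inductive Kind : Type
  | must
  | mays
  | nott
deriving DecidableEq

structure Nuance : Type where
  n1 : ℕ
  n2 : ℕ
  m1 : ℕ
  m2 : ℕ
  hn : n1 ≤ n2
  hm : m1 ≤ m2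

variable {A : Type} [Fintype A] [DecidableEq A]

/-- The set of attackers of `a`. -/
def pre (R : A → A → Prop) [DecidableRel R] (a : A) : Finset A :=
  Finset.univ.filter (fun b => R b a)

/-- Number of `out`-labelled arguments in the domain of a labelling. -/
def oCount {S : Finset A} (lam : ↥S → Label) : ℕ :=
  (Finset.univ.filter (fun b : ↥S => lam b = Label.out)).card

/-- Number of `in`-labelled arguments in the domain of a labelling. -/
def iCount {S : Finset A} (lam : ↥S → Label) : ℕ :=
  (Finset.univ.filter (fun b : ↥S => lam b = Label.inn)).card

/-- `x`-acceptance conditions for `x ∈ {must, may_s, not}`. -/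
def satA (Q : Nuance) (o : ℕ) : Kind → Prop
  | Kind.must => Q.n2 ≤ o
  | Kind.mays => Q.n1 ≤ o ∧ o < Q.n2
  | Kind.nott => o < Q.n1

/-- `y`-rejection conditions for `y ∈ {must, may_s, not}`. -/
def satR (Q : Nuance) (i : ℕ) : Kind → Prop
  | Kind.must => Q.m2 ≤ i
  | Kind.mays => Q.m1 ≤ i ∧ i < Q.m2
  | Kind.nott => i < Q.m1

/-- Label designation as a function of the nuance tuple and the counts `o`, `i`. -/
def designatesN (Q : Nuance) (o i : ℕ) (l : Label) : Prop :=
  (l = Label.inn ∧ Q.n1 ≤ o ∧ ¬ Q.m2 ≤ i) ∨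
  (l = Label.out ∧ Q.m1 ≤ i ∧ ¬ Q.n2 ≤ o) ∨
  (l = Label.undec ∧
    ((Q.n2 ≤ o ∧ Q.m2 ≤ i) ∨
     ((Q.n1 ≤ o ∧ o < Q.n2) ∨ (Q.m1 ≤ i ∧ i < Q.m2)) ∨
     (o < Q.n1 ∧ i < Q.m1)))

/-- `lam` designates `l` for `a` in the MMA `(A, R, fQ)`. -/
def designatesMMA (R : A → A → Prop) [DecidableRel R] (fQ : A → Nuance)
    (a : A) (lam : ↥(pre R a) → Label) (l : Label) : Prop :=
  designatesN (fQ a) (oCount lam) (iCount lam) l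

/-- The ADF `(A, R, C)` is a concretisation of the MMA `(A, R, fQ)`. -/
def IsConcretisation (R : A → A → Prop) [DecidableRel R]
    (C : ∀ a : A, (↥(pre R a) → Label) → Label) (fQ : A → Nuance) : Prop :=
  ∀ (a : A) (lam : ↥(pre R a) → Label), designatesMMA R fQ a lam (C a lam)

/-- Γ[fQ]: the set of all concretisations of the MMA `(A, R, fQ)`. -/
def Gamma (R : A → A → Prop) [DecidableRel R] (fQ : A → Nuance) :
    Set (∀ a : A, (↥(pre R a) → Label) → Label) :=
  {C | IsConcretisation R C fQ}

/-- The MMA `(A, R, fQ)` is an abstraction of the ADF `(A, R, C)`. -/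
def IsAbstraction (R : A → A → Prop) [DecidableRel R] (fQ : A → Nuance)
    (C : ∀ a : A, (↥(pre R a) → Label) → Label) : Prop :=
  ∀ a : A,
    (fQ a).n2 ≤ (pre R a).card + 1 ∧ (fQ a).m2 ≤ (pre R a).card + 1 ∧
    ∀ lam : ↥(pre R a) → Label,
      (oCount lam < (fQ a).n1 → iCount lam < (fQ a).m1 → C a lam = Label.undec) ∧
      ((fQ a).n1 ≤ oCount lam → oCount lam < (fQ a).n2 → iCount lam < (fQ a).m1 →
        (C a lam = Label.inn ∨ C a lam = Label.undec)) ∧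
      ((fQ a).n2 ≤ oCount lam → iCount lam < (fQ a).m1 → C a lam = Label.inn) ∧
      (oCount lam < (fQ a).n1 → (fQ a).m1 ≤ iCount lam → iCount lam < (fQ a).m2 →
        (C a lam = Label.out ∨ C a lam = Label.undec)) ∧
      ((fQ a).n1 ≤ oCount lam → oCount lam < (fQ a).n2 → (fQ a).m1 ≤ iCount lam →
        iCount lam < (fQ a).m2 →
        (C a lam = Label.inn ∨ C a lam = Label.out ∨ C a lam = Label.undec)) ∧
      ((fQ a).n2 ≤ oCount lam → (fQ a).m1 ≤ iCount lam → iCount lam < (fQ a).m2 →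
        (C a lam = Label.inn ∨ C a lam = Label.undec)) ∧
      (oCount lam < (fQ a).n1 → (fQ a).m2 ≤ iCount lam → C a lam = Label.out) ∧
      ((fQ a).n1 ≤ oCount lam → oCount lam < (fQ a).n2 → (fQ a).m2 ≤ iCount lam →
        (C a lam = Label.out ∨ C a lam = Label.undec)) ∧
      ((fQ a).n2 ≤ oCount lam → (fQ a).m2 ≤ iCount lam → C a lam = Label.undec)

/-- Δ[C]: the set of all abstractions of the ADF `(A, R, C)`. -/
def Delta (R : A → A → Prop) [DecidableRel R]
    (C : ∀ a : A, (↥(pre R a) → Label) → Label) : Set (A → Nuance) :=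
  {fQ | IsAbstraction R fQ C}

/-- The abstract order `⊴` on nuance tuples. -/
def nuanceLE (Q Q' : Nuance) : Prop :=
  Q'.n1 ≤ Q.n1 ∧ Q.n2 ≤ Q'.n2 ∧ Q'.m1 ≤ Q.m1 ∧ Q.m2 ≤ Q'.m2

/-- The abstract order `⊑` on MMAs over the same `(A, R)`. -/
def mmaLE (fQ fQ' : A → Nuance) : Prop := ∀ a : A, nuanceLE (fQ a) (fQ' a)

/-- Strict abstract order `⊏` on MMAs. -/
def mmaLT (fQ fQ' : A → Nuance) : Prop := mmaLE fQ fQ' ∧ ¬ mmaLE fQ' fQ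

/-- The order `⊑` on sets of MMAs. -/
def setLE (X' X : Set (A → Nuance)) : Prop := ∀ G ∈ X', ∃ F ∈ X, mmaLE G F

/-- `f_γ` on sets of MMAs. -/
def fGamma (R : A → A → Prop) [DecidableRel R] (X : Set (A → Nuance)) :
    Set (∀ a : A, (↥(pre R a) → Label) → Label) :=
  ⋃ fQ ∈ X, Gamma R fQ

/-- `f_α` on sets of ADFs. -/
def fAlpha (R : A → A → Prop) [DecidableRel R]
    (Y : Set (∀ a : A, (↥(pre R a) → Label) → Label)) : Set (A → Nuance) :=
  ⋃ C ∈ Y, {fQ | fQ ∈ Delta R C ∧ ¬ ∃ fQ' ∈ Delta R C, mmaLT fQ' fQ}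

/-- `f_α({C})` for a single ADF. -/
def fAlphaSingle (R : A → A → Prop) [DecidableRel R]
    (C : ∀ a : A, (↥(pre R a) → Label) → Label) : Set (A → Nuance) :=
  {fQ | fQ ∈ Delta R C ∧ ¬ ∃ fQ' ∈ Delta R C, mmaLT fQ' fQ}

/-- Restriction of a total labelling to `pre(a)`. -/
def restrictTo (R : A → A → Prop) [DecidableRel R] (lam : A → Label) (a : A) :
    ↥(pre R a) → Label :=
  fun b => lam b.1

/-- `lam` is an exact labelling of the MMA `(A, R, fQ)`. -/
def ExactMMA (R : A → A → Prop) [DecidableRel R] (fQ : A → Nuance)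
    (lam : A → Label) : Prop :=
  ∀ a : A, designatesMMA R fQ a (restrictTo R lam a) (lam a)

/-- `lam` is an exact labelling of the ADF `(A, R, C)`. -/
def ExactADF (R : A → A → Prop) [DecidableRel R]
    (C : ∀ a : A, (↥(pre R a) → Label) → Label) (lam : A → Label) : Prop :=
  ∀ a : A, C a (restrictTo R lam a) = lam a

/-- The order `⪯` on total labellings. -/
def preceq (lam1 lam2 : A → Label) : Prop :=
  ∀ a : A, (lam1 a = Label.inn → lam2 a = Label.inn) ∧
    (lam1 a = Label.out → lam2 a = Label.out)

/-- `maxi_A(lam)`: the maximal labellings above `lam` in `⪯`. -/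
def maxi (lam : A → Label) : Set (A → Label) :=
  {lx | preceq lam lx ∧ ∀ ly : A → Label, preceq lx ly → preceq ly lx}

/-- Total-labelling designation in an MMA. -/
def desMMAtotal (R : A → A → Prop) [DecidableRel R] (fQ : A → Nuance)
    (a : A) (lam : A → Label) (l : Label) : Prop :=
  designatesMMA R fQ a (restrictTo R lam a) l

/-- Total-labelling designation in an ADF. -/
def desADFtotal (R : A → A → Prop) [DecidableRel R]
    (C : ∀ a : A, (↥(pre R a) → Label) → Label)
    (a : A) (lam : A → Label) (l : Label) : Prop :=
  C a (restrictTo R lam a) = l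

open Classical in
/-- The consensus operator `Θ^H`, parameterised by the designation relation of `H`. -/
noncomputable def theta (D : A → (A → Label) → Label → Prop) (lam : A → Label) :
    A → Label :=
  fun a =>
    if ∀ lx ∈ maxi lam, D a lx Label.inn ∧ ∀ l : Label, D a lx l → l = Label.inn then
      Label.inn
    else if ∀ lx ∈ maxi lam, D a lx Label.out ∧ ∀ l : Label, D a lx l → l = Label.out then
      Label.out
    else Label.undec

/-- `lam` is a `⪯`-least fixpoint of `Th`. -/
def IsLfp (Th : (A → Label) → (A → Label)) (lam : A → Label) : Prop :=
  Th lam = lam ∧ ∀ mu : A → Label, Th mu = mu → preceq lam mu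

/-- `a` is credulously accepted/rejected (label `l`) w.r.t. the set `S` of labellings. -/
def CredIn (S : Set (A → Label)) (a : A) (l : Label) : Prop :=
  ∃ lam ∈ S, lam a = l

/-- `a` is skeptically accepted/rejected (label `l`) w.r.t. the set `S` of labellings. -/
def SkepIn (S : Set (A → Label)) (a : A) (l : Label) : Prop :=
  CredIn S a l ∧ ∀ lam ∈ S, lam a = l

/-- every labelling designates at least one label for every argument. -/
theorem designates_at_least_one (R : A → A → Prop) [DecidableRel R]
    (fQ : A → Nuance) (a : A) (lam : ↥(pre R a) → Label) :
    ∃ l : Label, designatesMMA R fQ a lam l := by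
  have hn := (fQ a).hn
  simp only [designatesMMA, designatesN]
  by_cases hA : (fQ a).n1 ≤ oCount lam
  · by_cases hR : (fQ a).m2 ≤ iCount lam
    · refine ⟨Label.undec, Or.inr (Or.inr ⟨rfl, ?_⟩)⟩
      omega
    · exact ⟨Label.inn, Or.inl ⟨rfl, hA, hR⟩⟩
  · by_cases hR : (fQ a).m1 ≤ iCount lam
    · exact ⟨Label.out, Or.inr (Or.inl ⟨rfl, hR, by omega⟩)⟩
    · refine ⟨Label.undec, Or.inr (Or.inr ⟨rfl, ?_⟩)⟩
      omega
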